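/- arXiv:1810.05335 — 2 statements merged into one kernel-verified Lean document; each statement's English description precedes it below -/
import Mathlib

section
/- Suppose B is a complete Boolean algebra, U is an ultrafilter on B, T is a complete countable theory, M is a full B-valued model of T, and p(x̄) is a partial type over M. Then the following are equivalent: (A) there are a full B-valued model N of T with M ⪯ N and a tuple b̄ from N such that ‖φ(b̄)‖_N ∈ U for every φ ∈ p(x̄); (B) the Łoś map L_p of p(x̄) has a multiplicative refinement in U. -/
open FirstOrder FirstOrder.Language Cardinal

namespace BVal

/-! ### Filters and ultrafilters on complete Boolean algebras -/

variable {B : Type} [CompleteBooleanAlgebra B]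

/-- A filter on a complete Boolean algebra. -/
def IsBFilter (D : Set B) : Prop :=
  ⊤ ∈ D ∧ ⊥ ∉ D ∧ (∀ a b : B, a ∈ D → a ≤ b → b ∈ D) ∧
    (∀ a b : B, a ∈ D → b ∈ D → a ⊓ b ∈ D)

/-- An ultrafilter on a complete Boolean algebra. -/
def IsBUltrafilter (U : Set B) : Prop :=
  IsBFilter U ∧ ∀ a : B, a ∈ U ∨ aᶜ ∈ U

/-- An antichain in a complete Boolean algebra: pairwise disjoint nonzero elements. -/
def IsBAntichain (S : Set B) : Prop :=
  (∀ a ∈ S, a ≠ ⊥) ∧ S.Pairwise fun a b => a ⊓ b = ⊥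

/-- `ccOf B` is the least cardinal `κ` such that every antichain of `B` has cardinality `< κ`. -/
noncomputable def ccOf (B : Type) [CompleteBooleanAlgebra B] : Cardinal :=
  sInf {κ : Cardinal | ∀ S : Set B, IsBAntichain S → Cardinal.mk S < κ}

/-! ### Regularity -/

/-- An `I`-quasiregular family: finite meets are nonzero, countably infinite meets are zero. -/
def IsQuasiregularFamily {I : Type} (a : I → B) : Prop :=
  (∀ s : Finset I, s.inf a ≠ ⊥) ∧
    ∀ J : Set I, J.Countable → J.Infinite → (⨅ i ∈ J, a i) = ⊥

/-- An `I`-regular family: quasiregular, and the set of nonzero elements deciding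
every member of the family is dense. -/
def IsRegularFamily {I : Type} (a : I → B) : Prop :=
  IsQuasiregularFamily a ∧
    ∀ b : B, b ≠ ⊥ → ∃ b' : B, b' ≠ ⊥ ∧ b' ≤ b ∧ ∀ i, b' ≤ a i ∨ b' ≤ (a i)ᶜ

/-- A filter `D` is `lam`-regular if it contains some `lam`-regular family. -/
def IsRegularFilter (D : Set B) (lam : Cardinal) : Prop :=
  ∃ a : Quotient.out lam → B, IsRegularFamily a ∧ ∀ α, a α ∈ D

/-! ### Boolean-valued structures -/

/-- Plug the tuple `b` into the `Fin`-indexed free variables of the bounded formula `φ`,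
relabelling the parameters along `e`. -/
def plugEmb {L : FirstOrder.Language.{0, 0}} {C D : Type} {k : ℕ} (φ : L.BoundedFormula C k)
    (e : C → D) (b : Fin k → D) : L.Formula D :=
  φ.toFormula.relabel (Sum.elim e b)

/-- Plug the tuple `b` into the `Fin`-indexed free variables of the bounded formula `φ`. -/
def plug {L : FirstOrder.Language.{0, 0}} {C : Type} {k : ℕ} (φ : L.BoundedFormula C k)
    (b : Fin k → C) : L.Formula C :=
  plugEmb φ id b

/-- The finite conjunction of a list of bounded formulas. -/
def listConj {L : FirstOrder.Language.{0, 0}} {α : Type} {n : ℕ} :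
    List (L.BoundedFormula α n) → L.BoundedFormula α n
  | [] => ⊤
  | φ :: l => φ ⊓ listConj l

/-- The axioms for a `B`-valued `L`-structure with carrier `C` and evaluation map `val`,
where formulas with parameters from `C` are encoded as `L.Formula C` (the parameters being
the free variables): logically valid formulas get value `⊤`, negation and conjunction are
respected, the value of an existential formula is the supremum of the values of its instances,
and distinct elements are not identified. -/
def IsBVal {L : FirstOrder.Language.{0, 0}} {C : Type} (val : L.Formula C → B) : Prop :=
  (∀ φ : L.Formula C,
      (∀ (N : Type) [L.Structure N] [Nonempty N] (v : C → N), φ.Realize v) → val φ = ⊤) ∧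
  (∀ φ : L.Formula C, val φ.not = (val φ)ᶜ) ∧
  (∀ φ ψ : L.Formula C, val (φ ⊓ ψ) = val φ ⊓ val ψ) ∧
  (∀ φ : L.BoundedFormula C 1, val φ.ex = ⨆ a : C, val (plug φ fun _ => a)) ∧
  (∀ a b : C, a ≠ b → val (Term.equal (Term.var a) (Term.var b)) < ⊤)

/-- Fullness of a `B`-valued structure: every existential value is attained. -/
def IsFull {L : FirstOrder.Language.{0, 0}} {C : Type} (val : L.Formula C → B) : Prop :=
  ∀ φ : L.BoundedFormula C 1, ∃ a : C, val φ.ex = val (plug φ fun _ => a)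

/-- The `B`-valued structure gives every sentence of `T` the value `⊤`. -/
def BModels {L : FirstOrder.Language.{0, 0}} {C : Type} (val : L.Formula C → B) (T : L.Theory) : Prop :=
  ∀ φ ∈ T, val (Formula.relabel (fun e : Empty => e.elim) φ) = ⊤

/-- `val` is a full `B`-valued model of `T`. -/
def IsFullBModel {L : FirstOrder.Language.{0, 0}} (T : L.Theory) {C : Type}
    (val : L.Formula C → B) : Prop :=
  IsBVal val ∧ IsFull val ∧ BModels val T

/-- An elementary map between `B`-valued structures. -/
def ElemMap {L : FirstOrder.Language.{0, 0}} {C D : Type} (v : L.Formula C → B) (w : L.Formula D → B)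
    (f : C → D) : Prop :=
  ∀ φ : L.Formula C, v φ = w (φ.relabel f)

/-- `lam⁺`-saturation for full `B`-valued models of `T`: elementary maps from models of
cardinality at most `lam` extend along elementary extensions. -/
def BSaturated {L : FirstOrder.Language.{0, 0}} (T : L.Theory) (lam : Cardinal) {C : Type}
    (val : L.Formula C → B) : Prop :=
  ∀ (C0 C1 : Type) (v0 : L.Formula C0 → B) (v1 : L.Formula C1 → B),
    IsFullBModel T v0 → IsFullBModel T v1 → Cardinal.mk C1 ≤ lam →
    ∀ ι : C0 → C1, ElemMap v0 v1 ι →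
    ∀ f : C0 → C, ElemMap v0 val f →
    ∃ g : C1 → C, ElemMap v1 val g ∧ g ∘ ι = f

/-- `lam⁺`-universality for full `B`-valued models of `T`. -/
def BUniversal {L : FirstOrder.Language.{0, 0}} (T : L.Theory) (lam : Cardinal) {C : Type}
    (val : L.Formula C → B) : Prop :=
  ∀ (C1 : Type) (v1 : L.Formula C1 → B), IsFullBModel T v1 → Cardinal.mk C1 ≤ lam →
    ∃ f : C1 → C, ElemMap v1 val f

/-! ### Ordinary structures, specializations, ordinary saturation -/

/-- A bundled (nonempty) ordinary `L`-structure. -/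
structure OrdStructure (L : FirstOrder.Language.{0, 0}) : Type 1 where
  carrier : Type
  [str : L.Structure carrier]
  [nonempty' : Nonempty carrier]

attribute [instance] OrdStructure.str OrdStructure.nonempty'

instance {L : FirstOrder.Language.{0, 0}} : CoeSort (OrdStructure L) Type :=
  ⟨OrdStructure.carrier⟩

/-- `(N, π)` is a specialization of the `B`-valued structure `val` at the ultrafilter `U`:
`π` is surjective and a formula holds in `N` of the images iff its value lies in `U`. -/
def IsSpecialization {L : FirstOrder.Language.{0, 0}} {C : Type} (val : L.Formula C → B) (U : Set B)
    (N : Type) [L.Structure N] (π : C → N) : Prop :=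
  Function.Surjective π ∧ ∀ φ : L.Formula C, (val φ ∈ U ↔ φ.Realize π)

/-- An ordinary structure `N` is `lam⁺`-saturated: every finitely satisfiable set of formulas
in one free variable with parameters from a subset of `N` of cardinality at most `lam`
is realized in `N`. -/
def OrdSaturated (L : FirstOrder.Language.{0, 0}) (lam : Cardinal) (N : Type) [L.Structure N] : Prop :=
  ∀ A : Set N, Cardinal.mk A ≤ lam →
    ∀ p : Set (L.BoundedFormula A 1),
      (∀ s : Finset (L.BoundedFormula A 1), ↑s ⊆ p →
        ∃ b : N, ∀ φ ∈ s, BoundedFormula.Realize φ Subtype.val fun _ => b) →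
      ∃ b : N, ∀ φ ∈ p, BoundedFormula.Realize φ Subtype.val fun _ => b

/-- The ultrafilter `U` on `B` `lam⁺`-saturates the theory `T`: for every `lam⁺`-saturated
full `B`-valued model of `T`, every specialization at `U` is `lam⁺`-saturated. -/
def Saturates {L : FirstOrder.Language.{0, 0}} (U : Set B) (T : L.Theory) (lam : Cardinal) : Prop :=
  ∀ (C : Type) (val : L.Formula C → B), IsFullBModel T val → BSaturated T lam val →
    ∀ (N : Type) [L.Structure N] (π : C → N), IsSpecialization val U N π →
      OrdSaturated L lam N

/-! ### Distributions -/

/-- An `I`-distribution in `B`. -/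
def IsDistribution {I : Type} (A : Finset I → B) : Prop :=
  A ∅ = ⊤ ∧ (∀ s, A s ≠ ⊥) ∧ ∀ s t : Finset I, s ⊆ t → A t ≤ A s

/-- A multiplicative distribution. -/
def MultiplicativeDist {I : Type} (A : Finset I → B) : Prop :=
  ∀ s : Finset I, A s = s.inf fun i => A {i}

/-- `A'` refines `A`. -/
def Refines {I : Type} (A' A : Finset I → B) : Prop :=
  ∀ s, A' s ≤ A s

/-- `A'` conservatively refines `A`. -/
def ConsRefines {I : Type} (A' A : Finset I → B) : Prop :=
  ∀ s : Finset I, A' s = A s ⊓ s.inf fun i => A' {i}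

/-- The distribution `A` lies in the filter `D`. -/
def InFilter {I : Type} (A : Finset I → B) (D : Set B) : Prop :=
  ∀ s, A s ∈ D

/-- `A` has a multiplicative refinement in `D`. -/
def HasMultRefinement {I : Type} (A : Finset I → B) (D : Set B) : Prop :=
  ∃ A' : Finset I → B, IsDistribution A' ∧ MultiplicativeDist A' ∧ InFilter A' D ∧ Refines A' A

/-- A filter `D` is `lam⁺`-good if every `lam`-distribution in `D` has a multiplicative
refinement in `D`. -/
def IsGoodFilter (D : Set B) (lam : Cardinal) : Prop :=
  ∀ A : Finset (Quotient.out lam) → B, IsDistribution A → InFilter A D →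
    HasMultRefinement A D

/-- A distribution is regular if the family of its values at singletons is regular. -/
def IsRegularDistribution {I : Type} (A : Finset I → B) : Prop :=
  IsRegularFamily fun i => A {i}

/-! ### Łoś maps and possibilities -/

/-- An `I`-sequence of formulas `φ_i(x̄, ȳ_i)`: `x̄` has length `n`, `ȳ_i` has length `m i`. -/
structure FormulaSeq (L : FirstOrder.Language.{0, 0}) (I : Type) : Type 1 where
  n : ℕ
  m : I → ℕ
  φ : ∀ i, L.Formula (Fin n ⊕ Fin (m i))

/-- The formula `∃ x̄, ⋀_{i ∈ s} φ_i(x̄, ā_i)`, with parameters `a`. -/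
noncomputable def losFormula {L : FirstOrder.Language.{0, 0}} {C I : Type} (Φ : FormulaSeq L I)
    (a : ∀ i, Fin (Φ.m i) → C) (s : Finset I) : L.Formula C :=
  BoundedFormula.exs (listConj (s.toList.map fun i =>
    BoundedFormula.relabel
      (fun v : Fin Φ.n ⊕ Fin (Φ.m i) =>
        Sum.elim (fun k => Sum.inr k) (fun j => Sum.inl (a i j)) v)
      (Φ.φ i)))

/-- `A` is a `(I, T, Φ)`-Łoś map. -/
def IsLosMapFor {L : FirstOrder.Language.{0, 0}} (T : L.Theory) {I : Type} (A : Finset I → B)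
    (Φ : FormulaSeq L I) : Prop :=
  ∃ (C : Type) (val : L.Formula C → B), IsFullBModel T val ∧
    ∃ a : ∀ i, Fin (Φ.m i) → C, ∀ s : Finset I, A s = val (losFormula Φ a s)

/-- `A` is a `(I, T)`-Łoś map. -/
def IsLosMap {L : FirstOrder.Language.{0, 0}} (T : L.Theory) {I : Type} (A : Finset I → B) : Prop :=
  ∃ Φ : FormulaSeq L I, IsLosMapFor T A Φ

/-- `A` is a `(I, T)`-Łoś map witnessed by a formula sequence whose `x̄` has length `k`. -/
def IsLosMapOfArity {L : FirstOrder.Language.{0, 0}} (T : L.Theory) {I : Type} (A : Finset I → B)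
    (k : ℕ) : Prop :=
  ∃ Φ : FormulaSeq L I, Φ.n = k ∧ IsLosMapFor T A Φ

/-- `A` is a `(I, T)`-possibility: it conservatively refines some `(I, T)`-Łoś map. -/
def IsPossibility {L : FirstOrder.Language.{0, 0}} (T : L.Theory) {I : Type} (A : Finset I → B) : Prop :=
  ∃ A0 : Finset I → B, IsDistribution A0 ∧ IsLosMap T A0 ∧ ConsRefines A A0

/-! ### Partial types -/

/-- `p` is a partial type over the `B`-valued structure `val`: each finite conjunction has
nonzero existential value. -/
def IsPartialType {L : FirstOrder.Language.{0, 0}} {C : Type} (val : L.Formula C → B) {k : ℕ}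
    (p : Set (L.BoundedFormula C k)) : Prop :=
  ∀ Γ : Finset (L.BoundedFormula C k), ↑Γ ⊆ p →
    val (BoundedFormula.exs (listConj Γ.toList)) ≠ ⊥

/-- `p` is a partial `U`-type over `val`: each finite conjunction has existential value in `U`. -/
def IsUType {L : FirstOrder.Language.{0, 0}} {C : Type} (val : L.Formula C → B) (U : Set B) {k : ℕ}
    (p : Set (L.BoundedFormula C k)) : Prop :=
  ∀ Γ : Finset (L.BoundedFormula C k), ↑Γ ⊆ p →
    val (BoundedFormula.exs (listConj Γ.toList)) ∈ U

/-- The Łoś map of the partial type `p`, as a `p`-distribution. -/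
noncomputable def losOfType {L : FirstOrder.Language.{0, 0}} {C : Type} (val : L.Formula C → B) {k : ℕ}
    (p : Set (L.BoundedFormula C k)) : Finset ↥p → B := fun Γ =>
  val (BoundedFormula.exs (listConj (Γ.toList.map Subtype.val)))

/-! ### Boolean ultrapowers -/

/-- The carrier of the Boolean ultrapower `M^B`: maximal antichains indexed by `M`. -/
def BUP (B : Type) [CompleteBooleanAlgebra B] (M : Type) : Type :=
  {a : M → B // (∀ m m' : M, m ≠ m' → a m ⊓ a m' = ⊥) ∧ (⨆ m, a m) = ⊤}

/-- The evaluation map of the Boolean ultrapower `M^B`. -/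
noncomputable def bupVal (B : Type) [CompleteBooleanAlgebra B] {L : FirstOrder.Language.{0, 0}}
    (M : Type) [L.Structure M] : L.Formula (BUP B M) → B := fun φ =>
  letI : DecidableEq (BUP B M) := Classical.decEq _
  ⨆ (w : BUP B M → M) (_ : φ.Realize w), φ.freeVarFinset.inf fun c => c.1 (w c)

/-- A bundled complete Boolean algebra. -/
structure CBA : Type 1 where
  carrier : Type
  [str : CompleteBooleanAlgebra carrier]

attribute [instance] CBA.str

instance : CoeSort CBA Type := ⟨CBA.carrier⟩

end BVal


namespace BVal

theorem le_of_inf_compl_bot {B : Type} [CompleteBooleanAlgebra B] {a b : B}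
    (h : a ⊓ bᶜ = ⊥) : a ≤ b :=
  disjoint_compl_right_iff.1 (disjoint_iff.2 h)

/-- A finest filter on a separating Stone-like space represents every set by an element of `B`
(a form of Sikorski's extension theorem). -/
theorem exists_representing_filter {B : Type} [CompleteBooleanAlgebra B] {S : Type}
    (st : S → B → Prop) (hc : ∀ V a, st V aᶜ ↔ ¬ st V a)
    (hi : ∀ V a b, st V (a ⊓ b) ↔ st V a ∧ st V b)
    (hs : ∀ a, (∀ V, st V a) → a = ⊤) :
    ∃ F : Filter S, (∀ a, (∀ᶠ V in F, st V a) → a = ⊤) ∧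
      ∀ X : S → Prop, ∃ b, ∀ᶠ V in F, (X V ↔ st V b) := by
  obtain ⟨F, -, hF⟩ := @zorn_le_nonempty₀ (Filter S)ᵒᵈ _
    {F : (Filter S)ᵒᵈ | ∀ a, (∀ᶠ V in OrderDual.ofDual F, st V a) → a = ⊤} (by
      intro c hcs hch y hy
      refine ⟨OrderDual.toDual (⨅ F ∈ c, OrderDual.ofDual F), ?_, ?_⟩
      · intro a ha
        have hd : DirectedOn ((fun F : (Filter S)ᵒᵈ => OrderDual.ofDual F) ⁻¹'o (· ≥ ·)) c := by
          intro x hx z hz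
          rcases hch.total hx hz with h | h
          · exact ⟨z, hz, h, le_rfl⟩
          · exact ⟨x, hx, le_rfl, h⟩
        rw [Filter.Eventually] at ha
        have ha' := (Filter.mem_biInf_of_directed hd ⟨y, hy⟩).1 ha
        obtain ⟨F, hFc, hFa⟩ := ha'
        exact hcs hFc a hFa
      · intro z hz
        exact (iInf₂_le z hz : (⨅ F ∈ c, OrderDual.ofDual F) ≤ OrderDual.ofDual z))
    (OrderDual.toDual (⊤ : Filter S)) (by
      intro a ha
      exact hs a (by simpa using ha))
  refine ⟨OrderDual.ofDual F, hF.1, fun X => ?_⟩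
  set G : Filter S := OrderDual.ofDual F with hG
  have hG1 : ∀ a, (∀ᶠ V in G, st V a) → a = ⊤ := hF.1
  set b : B := sSup {d | ∀ᶠ V in G, st V d → X V} with hb
  refine ⟨b, ?_⟩
  have hmem : ∀ a, (∀ᶠ V in G ⊓ Filter.principal {V | X V ↔ st V b}, st V a) → a = ⊤ := by
    intro a ha
    rw [Filter.eventually_inf_principal] at ha
    have h1 : aᶜ ⊓ bᶜ ≤ b := by
      apply le_sSup
      filter_upwards [ha] with V hV hV'
      rw [hi, hc, hc] at hV'
      by_contra hX
      exact hV'.1 (hV (by simp [hX, hV'.2]))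
    have h2 : aᶜ ≤ b := by
      have : aᶜ = aᶜ ⊓ b ⊔ aᶜ ⊓ bᶜ := (sup_inf_inf_compl).symm
      rw [this]
      exact sup_le inf_le_right h1
    have h3 : b ≤ a := by
      apply sSup_le
      intro d hd
      have : (d ⊓ aᶜ)ᶜ = ⊤ := by
        apply hG1
        filter_upwards [ha, hd] with V hV hd
        rw [hc, hi, hc]
        rintro ⟨h4, h5⟩
        have h6 : st V b := by
          have : aᶜ ⊓ b = aᶜ := inf_eq_left.2 h2
          have h7 := (hc V a).2 h5
          rw [← this, hi] at h7
          exact h7.2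
        exact h5 (hV (by simp [hd h4, h6]))
      rw [compl_eq_top] at this
      exact le_of_inf_compl_bot this
    have h4 : aᶜ ≤ a := h2.trans h3
    rw [← compl_eq_bot]
    have : aᶜ = aᶜ ⊓ a := (inf_eq_left.2 h4).symm
    rw [this, compl_inf_eq_bot]
  have := hF.2 (y := OrderDual.toDual (G ⊓ Filter.principal {V | X V ↔ st V b})) hmem
    (inf_le_left (α := Filter S))
  have h8 : G ≤ G ⊓ Filter.principal {V | X V ↔ st V b} := this
  exact Filter.le_principal_iff.1 (h8.trans inf_le_right)

/-- Compactness for families of formulas with free variables. -/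
theorem compactness_family {L : FirstOrder.Language.{0, 0}} {α ι : Type} (g : ι → L.Formula α)
    (h : ∀ s : Finset ι, ∃ (N : Type) (_ : L.Structure N) (_ : Nonempty N) (v : α → N),
      ∀ i ∈ s, (g i).Realize v) :
    ∃ (N : Type) (_ : L.Structure N) (_ : Nonempty N) (v : α → N), ∀ i, (g i).Realize v := by
  classical
  let T : (L[[α]]).Theory := Set.range fun i => Formula.equivSentence (g i)
  have hT : T.IsSatisfiable := by
    rw [Theory.isSatisfiable_iff_isFinitelySatisfiable]
    intro T0 hT0
    have hT0' : (T0 : Set _) ⊆ (fun i => Formula.equivSentence (g i)) '' Set.univ := by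
      rw [Set.image_univ]; exact hT0
    rw [Finset.subset_set_image_iff] at hT0'
    obtain ⟨s, -, rfl⟩ := hT0'
    obtain ⟨N, _, _, v, hv⟩ := h s
    let := constantsOn.structure v
    have : N ⊨ ((s.image fun i => Formula.equivSentence (g i) : Finset _) : (L[[α]]).Theory) := by
      rw [Theory.model_iff]
      intro φ hφ
      simp only [Finset.coe_image, Set.mem_image, Finset.mem_coe] at hφ
      obtain ⟨i, hi, rfl⟩ := hφ
      rw [Formula.realize_equivSentence]
      exact hv i hi
    exact Theory.Model.isSatisfiable N
  obtain ⟨M⟩ := hT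
  let : L.Structure M := (L.lhomWithConstants α).reduct M
  have : (L.lhomWithConstants α).IsExpansionOn M := LHom.isExpansionOn_reduct _ _
  refine ⟨M, inferInstance, inferInstance, fun a => (L.con a : M), fun i => ?_⟩
  rw [← Formula.realize_equivSentence]
  exact (Theory.model_iff T).1 M.is_model _ ⟨i, rfl⟩

section
variable {B : Type} [CompleteBooleanAlgebra B] {L : FirstOrder.Language.{0, 0}}

theorem realize_listConj {α N : Type} [L.Structure N] {n : ℕ} (l : List (L.BoundedFormula α n))
    (v : α → N) (xs : Fin n → N) :
    (listConj l).Realize v xs ↔ ∀ φ ∈ l, φ.Realize v xs := by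
  induction l with
  | nil => simp [listConj]
  | cons a l ih => simp [listConj, ih]

theorem realize_plugEmb {C D N : Type} [L.Structure N] {k : ℕ} (φ : L.BoundedFormula C k)
    (e : C → D) (b : Fin k → D) (v : D → N) :
    (plugEmb φ e b).Realize v ↔ φ.Realize (v ∘ e) (v ∘ b) := by
  rw [plugEmb, Formula.realize_relabel, BoundedFormula.realize_toFormula]
  rfl

theorem IsBVal.mono {C : Type} {val : L.Formula C → B} (h : IsBVal val) {φ ψ : L.Formula C}
    (hφ : ∀ (N : Type) [L.Structure N] [Nonempty N] (v : C → N), φ.Realize v → ψ.Realize v) :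
    val φ ≤ val ψ := by
  have h1 : val (φ ⊓ ψ.not).not = ⊤ := by
    apply h.1
    intro N _ _ v
    have := hφ N v
    simp only [Formula.Realize, BoundedFormula.realize_not, BoundedFormula.realize_inf] at this ⊢
    tauto
  rw [h.2.1, h.2.2.1, h.2.1, compl_eq_top] at h1
  exact le_of_inf_compl_bot h1

theorem IsBVal.listConj {C : Type} {val : L.Formula C → B} (h : IsBVal val) (P : B → Prop)
    (ht : P ⊤) (hi : ∀ a b, P a → P b → P (a ⊓ b)) (l : List (L.Formula C))
    (hl : ∀ φ ∈ l, P (val φ)) : P (val (BVal.listConj l)) := by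
  induction l with
  | nil =>
    have : val (BVal.listConj []) = ⊤ := by
      apply h.1
      intro N _ _ v
      simp [BVal.listConj, Formula.Realize]
    rw [this]; exact ht
  | cons a l ih =>
    have : val (BVal.listConj (a :: l)) = val a ⊓ val (BVal.listConj l) := h.2.2.1 _ _
    rw [this]
    exact hi _ _ (hl _ (by simp)) (ih fun φ hφ => hl _ (by simp [hφ]))

theorem forward {C C' : Type} {U : Set B} (hU : IsBUltrafilter U) {val : L.Formula C → B}
    {v' : L.Formula C' → B} (h' : IsBVal v') {k : ℕ} (p : Set (L.BoundedFormula C k))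
    (e : C → C') (he : ElemMap val v' e) (b : Fin k → C')
    (hb : ∀ φ ∈ p, v' (plugEmb φ e b) ∈ U) :
    ∃ A' : Finset ↥p → B, IsDistribution A' ∧ MultiplicativeDist A' ∧
        InFilter A' U ∧ Refines A' (losOfType val p) := by
  have hin : ∀ s : Finset ↥p, (s.inf fun φ => v' (plugEmb φ.1 e b)) ∈ U := by
    intro s
    classical
    induction s using Finset.induction_on with
    | empty => simpa using hU.1.1
    | insert a s _ ih =>
      rw [Finset.inf_insert]
      exact hU.1.2.2.2 _ _ (hb _ a.2) ih
  refine ⟨fun s => s.inf fun φ => v' (plugEmb φ.1 e b), ⟨by simp, ?_, ?_⟩, ?_, hin, ?_⟩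
  · intro s hs
    exact hU.1.2.1 (hs ▸ hin s)
  · intro s t hst
    exact Finset.inf_mono hst
  · intro s
    simp
  · intro s
    rw [losOfType, he]
    refine le_trans (b := v' (BVal.listConj (s.toList.map fun φ => plugEmb φ.1 e b))) ?_ ?_
    · refine h'.listConj (fun x => (s.inf fun φ => v' (plugEmb φ.1 e b)) ≤ x) le_top
        (fun _ _ => le_inf) _ ?_
      intro φ hφ
      simp only [List.mem_map, Finset.mem_toList] at hφ
      obtain ⟨ψ, hψ, rfl⟩ := hφ
      exact Finset.inf_le (f := fun φ : ↥p => v' (plugEmb φ.1 e b)) hψ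
    · apply h'.mono
      intro N _ _ v hv
      rw [Formula.realize_relabel, BoundedFormula.realize_exs]
      refine ⟨v ∘ b, ?_⟩
      rw [Formula.Realize, realize_listConj] at hv
      rw [realize_listConj]
      intro φ hφ
      simp only [List.mem_map] at hφ
      obtain ⟨ψ, hψ, rfl⟩ := hφ
      have := hv (plugEmb ψ.1 e b) (by simp only [List.mem_map]; exact ⟨ψ, hψ, rfl⟩)
      exact (realize_plugEmb _ _ _ _).1 this

/-- The space of prime ideals. -/
def PIdeal (B : Type) [CompleteBooleanAlgebra B] : Type := {I : Order.Ideal B // I.IsPrime}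

theorem pideal_compl (V : PIdeal B) (a : B) : aᶜ ∉ V.1 ↔ ¬ a ∉ V.1 := by
  constructor
  · intro h
    have := V.2.mem_or_compl_mem (x := a)
    tauto
  · intro h h'
    push Not at h
    have := Order.Ideal.sup_mem h h'
    rw [sup_compl_eq_top] at this
    exact (V.2.toIsProper).top_notMem this

theorem pideal_inf (V : PIdeal B) (a b : B) : a ⊓ b ∉ V.1 ↔ a ∉ V.1 ∧ b ∉ V.1 := by
  constructor
  · intro h
    exact ⟨fun h' => h (V.1.lower inf_le_left h'), fun h' => h (V.1.lower inf_le_right h')⟩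
  · rintro ⟨h1, h2⟩ h
    exact (V.2.mem_or_mem h).elim h1 h2

theorem pideal_sep (a : B) (h : ∀ V : PIdeal B, a ∉ V.1) : a = ⊤ := by
  by_contra ha
  have hd : Disjoint ((Order.PFilter.principal (⊤ : B)) : Set B)
      ((Order.Ideal.principal a : Order.Ideal B) : Set B) := by
    rw [Set.disjoint_left]
    intro x hx hx'
    have h1 : ⊤ ≤ x := hx
    have h2 : x ≤ a := hx'
    exact ha (top_le_iff.1 (h1.trans h2))
  obtain ⟨J, hJ, hle, -⟩ := DistribLattice.prime_ideal_of_disjoint_filter_ideal hd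
  exact h ⟨J, hJ⟩ (hle (Order.Ideal.mem_principal.2 le_rfl))

theorem local_model {C : Type} {val : L.Formula C → B} (hM : IsBVal val) {k : ℕ}
    (p : Set (L.BoundedFormula C k)) (A' : Finset ↥p → B) (hmul : MultiplicativeDist A')
    (href : Refines A' (losOfType val p)) (V : PIdeal B) :
    ∃ (N : Type) (_ : L.Structure N) (_ : Nonempty N) (e : C → N) (b : Fin k → N),
      (∀ φ : L.Formula C, φ.Realize e ↔ val φ ∉ V.1) ∧
      ∀ φ : ↥p, A' {φ} ∉ V.1 → φ.1.Realize e b := by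
  have htop : (⊤ : B) ∉ V.1 := (V.2.toIsProper).top_notMem
  obtain ⟨N, i1, i2, v, hv⟩ := compactness_family (L := L) (α := C ⊕ Fin k)
    (ι := {φ : L.Formula C // val φ ∉ V.1} ⊕ {φ : ↥p // A' {φ} ∉ V.1})
    (Sum.elim (fun φ => φ.1.relabel Sum.inl) (fun φ => φ.1.1.toFormula)) (by
      classical
      intro s
      let Γ : Finset ↥p := s.toRight.map (Function.Embedding.subtype _)
      let χ1 : L.Formula C := BVal.listConj (s.toLeft.toList.map Subtype.val)
      let χ2 : L.Formula C := BoundedFormula.exs (BVal.listConj (Γ.toList.map Subtype.val))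
      have h1 : val χ1 ∉ V.1 := by
        apply hM.listConj (fun x => x ∉ V.1) htop fun a b ha hb => (pideal_inf V a b).2 ⟨ha, hb⟩
        intro φ hφ
        simp only [List.mem_map] at hφ
        obtain ⟨ψ, -, rfl⟩ := hφ
        exact ψ.2
      have h2 : val χ2 ∉ V.1 := by
        intro hx
        have hx' : A' Γ ∈ V.1 := V.1.lower (href Γ) hx
        rw [hmul] at hx'
        revert hx'
        have : ∀ φ ∈ Γ, A' {φ} ∉ V.1 := by
          intro φ hφ
          simp only [Γ, Finset.mem_map] at hφ
          obtain ⟨ψ, -, rfl⟩ := hφ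
          exact ψ.2
        clear_value Γ
        clear χ2 hx
        induction Γ using Finset.induction_on with
        | empty => simpa using htop
        | insert a t _ ih =>
          rw [Finset.inf_insert]
          exact (pideal_inf V _ _).2 ⟨this a (by simp), ih fun φ hφ => this φ (by simp [hφ])⟩
      have h3 : val (χ1 ⊓ χ2) ∉ V.1 := by
        rw [hM.2.2.1]
        exact (pideal_inf V _ _).2 ⟨h1, h2⟩
      by_contra hcon
      apply h3
      have h4 : val (χ1 ⊓ χ2).not = ⊤ := by
        apply hM.1
        intro N _ _ v
        by_contra hv
        apply hcon
        simp only [Formula.Realize, BoundedFormula.realize_not, BoundedFormula.realize_inf,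
          not_not] at hv
        obtain ⟨hv1, hv2⟩ := hv
        rw [realize_listConj] at hv1
        have hv2' : χ2.Realize v := hv2
        rw [BoundedFormula.realize_exs] at hv2'
        obtain ⟨xs, hxs⟩ := hv2'
        rw [realize_listConj] at hxs
        refine ⟨N, inferInstance, inferInstance, Sum.elim v xs, ?_⟩
        rintro (φ | φ) hφ
        · rw [Sum.elim_inl, Formula.realize_relabel]
          exact hv1 φ.1 (by
            simp only [List.mem_map, Finset.mem_toList]
            exact ⟨φ, by simpa using hφ, rfl⟩)
        · rw [Sum.elim_inr, BoundedFormula.realize_toFormula]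
          exact hxs φ.1.1 (by
            simp only [List.mem_map, Finset.mem_toList]
            refine ⟨φ.1, ?_, rfl⟩
            simp only [Γ, Finset.mem_map]
            exact ⟨φ, by simpa using hφ, rfl⟩)
      rw [hM.2.1, compl_eq_top] at h4
      rw [h4]
      exact V.1.bot_mem)
  have key : ∀ φ : L.Formula C, val φ ∉ V.1 → φ.Realize (v ∘ Sum.inl) := by
    intro φ hφ
    have := hv (Sum.inl ⟨φ, hφ⟩)
    rwa [Sum.elim_inl, Formula.realize_relabel] at this
  refine ⟨N, i1, i2, v ∘ Sum.inl, v ∘ Sum.inr, fun φ => ⟨fun h => ?_, key φ⟩, fun φ hφ => ?_⟩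
  · by_contra hx
    have := key φ.not (by rw [hM.2.1]; exact (pideal_compl V _).2 (fun h => h hx))
    exact (BoundedFormula.realize_not.1 this) h
  · have := hv (Sum.inr ⟨φ, hφ⟩)
    rwa [Sum.elim_inr, BoundedFormula.realize_toFormula] at this

theorem eventually_realize {S D : Type} (F : Filter S) (N : S → Type) [∀ V, L.Structure (N V)]
    (φ : L.Formula D) (u w : D → ∀ V, N V) (h : ∀ d, ∀ᶠ V in F, u d V = w d V) :
    ∀ᶠ V in F, (φ.Realize (fun d => u d V) ↔ φ.Realize fun d => w d V) := by
  classical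
  have : ∀ᶠ V in F, ∀ d ∈ φ.freeVarFinset, u d V = w d V :=
    (Filter.eventually_all_finset _).2 fun d _ => h d
  filter_upwards [this] with V hV
  rw [Formula.Realize, Formula.Realize,
    ← BoundedFormula.realize_restrictFreeVar (φ := φ) (f := id) (v := fun d => u d.1 V)
      (fun d => u d V) (fun _ => rfl),
    ← BoundedFormula.realize_restrictFreeVar (φ := φ) (f := id) (v := fun d => w d.1 V)
      (fun d => w d V) (fun _ => rfl)]
  have : (fun d : φ.freeVarFinset => u d.1 V) = fun d => w d.1 V := funext fun d => hV d.1 d.2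
  rw [this]

theorem backward {C : Type} {T : L.Theory} {U : Set B} (hU : IsBUltrafilter U)
    {val : L.Formula C → B}
    (hM : IsFullBModel T val) {k : ℕ} (p : Set (L.BoundedFormula C k)) (A' : Finset ↥p → B)
    (hmul : MultiplicativeDist A') (hin : InFilter A' U)
    (href : Refines A' (losOfType val p)) :
    ∃ (C' : Type) (v' : L.Formula C' → B), IsFullBModel T v' ∧
        ∃ e : C → C', ElemMap val v' e ∧
          ∃ b : Fin k → C', ∀ φ ∈ p, v' (plugEmb φ e b) ∈ U := by
  choose N iS iN e b he hb using local_model hM.1 p A' hmul href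
  obtain ⟨F, hF1, hF2⟩ := exists_representing_filter (S := PIdeal B) (fun V a => a ∉ V.1)
    pideal_compl pideal_inf pideal_sep
  choose r hr using hF2
  have hle : ∀ a b : B, (∀ᶠ V in F, a ∉ V.1 → b ∉ V.1) → a ≤ b := by
    intro a b h
    have : (a ⊓ bᶜ)ᶜ = ⊤ := by
      apply hF1
      filter_upwards [h] with V hV
      rw [pideal_compl, pideal_inf, pideal_compl]
      tauto
    rw [compl_eq_top] at this
    exact le_of_inf_compl_bot this
  have hrle : ∀ X Y : PIdeal B → Prop, (∀ᶠ V in F, X V → Y V) → r X ≤ r Y := by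
    intro X Y h
    apply hle
    filter_upwards [h, hr X, hr Y] with V h1 h2 h3
    rw [← h2, ← h3]; exact h1
  have hrc : ∀ X Y : PIdeal B → Prop, (∀ᶠ V in F, (X V ↔ Y V)) → r X = r Y := fun X Y h =>
    le_antisymm (hrle _ _ (h.mono fun _ h => h.1)) (hrle _ _ (h.mono fun _ h => h.2))
  have hreq : ∀ (X : PIdeal B → Prop) a, (∀ᶠ V in F, (X V ↔ a ∉ V.1)) → r X = a := by
    intro X a h
    apply le_antisymm <;> apply hle <;> filter_upwards [h, hr X] with V h1 h2
    · rw [← h1, ← h2]; exact id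
    · rw [← h1, ← h2]; exact id
  have htop : ∀ V : PIdeal B, (⊤ : B) ∉ V.1 := fun V => (V.2.toIsProper).top_notMem
  have hrtop : ∀ X : PIdeal B → Prop, r X = ⊤ → ∀ᶠ V in F, X V := by
    intro X h
    filter_upwards [hr X] with V hV
    rw [hV, h]; exact htop V
  let st : Setoid (∀ V, N V) := F.productSetoid N
  let C' : Type := Quotient st
  let o : C' → ∀ V, N V := Quotient.out
  have ho : ∀ f : ∀ V, N V, ∀ᶠ V in F, o (Quotient.mk st f) V = f V := fun f =>
    Quotient.exact (Quotient.out_eq (Quotient.mk st f))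
  let v' : L.Formula C' → B := fun φ => r fun V => φ.Realize fun q => o q V
  let E : C → C' := fun c => Quotient.mk st fun V => e V c
  let bb : Fin k → C' := fun i => Quotient.mk st fun V => b V i
  have hfull : ∀ φ : L.BoundedFormula C' 1, ∃ a : C', v' φ.ex ≤ v' (plug φ fun _ => a) := by
    intro φ
    have : ∀ V, ∃ x : N V, (φ.ex.Realize (fun q => o q V) default →
        φ.Realize (fun q => o q V) fun _ => x) := by
      intro V
      by_cases h : φ.ex.Realize (fun q => o q V) default
      · rw [BoundedFormula.realize_ex] at h
        obtain ⟨x, hx⟩ := h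
        refine ⟨x, fun _ => ?_⟩
        convert hx using 1
        funext i
        have hi : i = Fin.last 0 := Subsingleton.elim (α := Fin 1) _ _
        rw [hi, Fin.snoc_last]
      · exact ⟨(iN V).some, fun h' => absurd h' h⟩
    choose f hf using this
    refine ⟨Quotient.mk st f, hrle _ _ ?_⟩
    filter_upwards [ho f] with V hV h
    rw [plug, realize_plugEmb]
    have h1 := hf V h
    rw [← hV] at h1
    exact h1
  have hub : ∀ (φ : L.BoundedFormula C' 1) (a : C'), v' (plug φ fun _ => a) ≤ v' φ.ex := by
    intro φ a
    apply hrle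
    refine Filter.Eventually.of_forall fun V h => ?_
    rw [plug, realize_plugEmb] at h
    rw [Formula.Realize, BoundedFormula.realize_ex]
    refine ⟨o a V, ?_⟩
    have h2 : (Fin.snoc default (o a V) : Fin 1 → N V) = fun _ => o a V := by
      funext i
      have hi : i = Fin.last 0 := Subsingleton.elim (α := Fin 1) _ _
      rw [hi, Fin.snoc_last]
    rw [h2]
    exact h
  refine ⟨C', v', ⟨⟨?_, ?_, ?_, ?_, ?_⟩, ?_, ?_⟩, E, ?_, bb, ?_⟩
  · intro φ hφ
    apply hreq
    refine Filter.Eventually.of_forall fun V => ?_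
    exact iff_of_true (hφ (N V) _) (htop V)
  · intro φ
    apply hreq
    filter_upwards [hr fun V => φ.Realize fun q => o q V] with V hV
    rw [pideal_compl, ← hV]
    exact BoundedFormula.realize_not
  · intro φ ψ
    apply hreq
    filter_upwards [hr fun V => φ.Realize fun q => o q V,
      hr fun V => ψ.Realize fun q => o q V] with V hV hV'
    rw [pideal_inf, ← hV, ← hV']
    exact BoundedFormula.realize_inf
  · intro φ
    apply le_antisymm
    · obtain ⟨a, ha⟩ := hfull φ
      exact ha.trans (le_iSup (fun a => v' (plug φ fun _ => a)) a)
    · exact iSup_le (hub φ)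
  · intro x y hxy
    rw [lt_top_iff_ne_top]
    intro h
    apply hxy
    rw [← Quotient.out_eq x, ← Quotient.out_eq y]
    apply Quotient.sound
    have := hrtop _ h
    filter_upwards [this] with V hV
    rw [Formula.realize_equal] at hV
    exact hV
  · intro φ
    obtain ⟨a, ha⟩ := hfull φ
    exact ⟨a, le_antisymm ha (hub φ a)⟩
  · intro φ hφ
    apply hreq
    refine Filter.Eventually.of_forall fun V => ?_
    refine iff_of_true ?_ (htop V)
    have h1 := (he V (Formula.relabel (fun e : Empty => e.elim) φ)).2
      (by rw [hM.2.2 φ hφ]; exact htop V)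
    rw [Formula.realize_relabel] at h1 ⊢
    convert h1 using 1
  · intro φ
    symm
    apply hreq
    filter_upwards [eventually_realize F N φ (fun c => o (E c)) (fun c V => e V c)
      fun c => ho _] with V hV
    rw [Formula.realize_relabel, ← he V φ, ← hV]
    rfl
  · intro φ hφ
    refine hU.1.2.2.1 _ _ (hin {⟨φ, hφ⟩}) ?_
    apply hle
    have := eventually_realize F N φ.toFormula
      (Sum.elim (fun c => o (E c)) (fun i => o (bb i)))
      (Sum.elim (fun c V => e V c) (fun i V => b V i)) (by
        rintro (c | i)
        · exact ho _
        · exact ho _)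
    filter_upwards [this, hr fun V => (plugEmb φ E bb).Realize fun q => o q V] with V hV hV' hA
    refine hV'.1 ?_
    rw [realize_plugEmb]
    rw [BoundedFormula.realize_toFormula, BoundedFormula.realize_toFormula] at hV
    exact hV.2 (hb V ⟨φ, hφ⟩ hA)

end

end BVal

open BVal

/-- **Type realization in an elementary extension corresponds to multiplicative
refinements of the Łoś map** (Theorem 4.10). -/
theorem stmt6_type_realization (B : Type) [CompleteBooleanAlgebra B]
    (L : FirstOrder.Language.{0, 0}) (hL : L.card ≤ ℵ₀)
    (T : L.Theory) (hT : T.IsComplete) (U : Set B) (hU : IsBUltrafilter U)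
    (C : Type) (val : L.Formula C → B) (hM : IsFullBModel T val)
    (k : ℕ) (p : Set (L.BoundedFormula C k)) (hp : IsPartialType val p) :
    (∃ (C' : Type) (v' : L.Formula C' → B), IsFullBModel T v' ∧
        ∃ e : C → C', ElemMap val v' e ∧
          ∃ b : Fin k → C', ∀ φ ∈ p, v' (plugEmb φ e b) ∈ U) ↔
      ∃ A' : Finset ↥p → B, IsDistribution A' ∧ MultiplicativeDist A' ∧
        InFilter A' U ∧ Refines A' (losOfType val p) := by
  constructor
  · rintro ⟨C', v', h', e, he, b, hb⟩
    exact forward hU h'.1 p e he b hb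
  · rintro ⟨A', -, hmul, hin, href⟩
    exact backward hU hM p A' hmul hin href
end

section
/- Let B be a complete Boolean algebra and U an ultrafilter on B. If A is an I-distribution in U and A' is a conservative refinement of A that is in U, then A' has a multiplicative refinement in U if and only if A has a multiplicative refinement in U. -/
open FirstOrder FirstOrder.Language Cardinal

open BVal

/-- **Conservative refinements preserve the existence of multiplicative refinements**
(Lemma 5.2). -/
theorem stmt8_conservative_refinement (B : Type) [CompleteBooleanAlgebra B]
    (U : Set B) (hU : IsBUltrafilter U) (I : Type) (A A' : Finset I → B)
    (hA : IsDistribution A) (hAU : InFilter A U)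
    (hA' : IsDistribution A') (hcons : ConsRefines A' A) (hA'U : InFilter A' U) :
    HasMultRefinement A' U ↔ HasMultRefinement A U := by
  have hF := hU.1
  obtain ⟨htop, hbot, hup, hinf⟩ := hF
  have key : ∀ (f : I → B), (∀ i, f i ∈ U) → ∀ s : Finset I, s.inf f ∈ U := by
    intro f hf s
    classical
    induction s using Finset.induction_on with
    | empty => simpa using htop
    | insert a s _ ih =>
      rw [Finset.inf_insert]
      exact hinf _ _ (hf a) ih
  constructor
  · rintro ⟨C, h1, h2, h3, h4⟩
    refine ⟨C, h1, h2, h3, fun s => (h4 s).trans ?_⟩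
    rw [hcons s]
    exact inf_le_left
  · rintro ⟨C, h1, h2, h3, h4⟩
    have hmem : ∀ s : Finset I, (s.inf fun i => C {i} ⊓ A' {i}) ∈ U :=
      key _ fun i => hinf _ _ (h3 _) (hA'U _)
    refine ⟨fun s => s.inf fun i => C {i} ⊓ A' {i}, ⟨?_, ?_, ?_⟩, ?_, hmem, ?_⟩
    · simp
    · intro s h
      apply hbot
      rw [← h]
      exact hmem s
    · intro s t hst
      exact Finset.inf_mono hst
    · intro s
      simp
    · intro s
      show (s.inf fun i => C {i} ⊓ A' {i}) ≤ A' s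
      rw [hcons s]
      refine le_inf (le_trans ?_ (h4 s)) (Finset.inf_mono_fun fun i _ => inf_le_right)
      rw [h2 s]
      exact Finset.inf_mono_fun fun i _ => inf_le_left
end
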